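/- A regressive-selector criterion for being almost Souslin: let T be an ω₁-tree all of whose levels T_α are countable, let C ⊆ ω₁ be a club, and suppose that for each α ∈ C there is a function g_α : T_α → T such that g_α(x) <_T x for every x ∈ T_α, and such that for all α, β ∈ C, x ∈ T_α, y ∈ T_β, if g_α(x) = g_β(y) then x and y are comparable in T. Then T is almost Souslin: for every antichain X ⊆ T, the set S_X = {ht(x) : x ∈ X} is non-stationary in ω₁. -/

import Mathlib

open Ordinal Set

/-- `C` is a club subset of `ω₁`: a set of countable ordinals that is unbounded in `ω₁`
and closed, i.e. contains the supremum of each of its nonempty subsets that is bounded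
below `ω₁`. -/
def IsClubBelowOmega1 (C : Set Ordinal) : Prop :=
  (∀ c ∈ C, c < ω₁) ∧
  (∀ o < ω₁, ∃ c ∈ C, o < c) ∧
  (∀ S : Set Ordinal, S ⊆ C → S.Nonempty → (∃ β < ω₁, ∀ o ∈ S, o ≤ β) → sSup S ∈ C)

/-- An `ω₁`-tree structure on a partial order `α` with height function `ht`:
the predecessors of every point are well-ordered by the tree order, `ht x` is the
order type of the set of predecessors of `x`, every height is a countable ordinal,
and every level `T_o`, `o < ω₁`, is nonempty. -/
structure IsOmega1Tree {α : Type*} [PartialOrder α] (ht : α → Ordinal) : Prop where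
  predWellOrder : ∀ x : α, IsWellOrder (Set.Iio x) (Subrel (· < ·) (Set.Iio x))
  ht_eq : ∀ x : α, ht x = @Ordinal.type _ (Subrel (· < ·) (Set.Iio x)) (predWellOrder x)
  ht_lt : ∀ x : α, ht x < ω₁
  level_nonempty : ∀ o < ω₁, ∃ x : α, ht x = o

theorem IsOmega1Tree.strictMono {α : Type*} [PartialOrder α] {ht : α → Ordinal}
    (hT : IsOmega1Tree ht) : StrictMono ht := by
  intro x y hxy
  rw [hT.ht_eq x, hT.ht_eq y]
  have seg := (PrincipalSeg.ofElement (· < ·) x).codRestrict (Iio y)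
    (fun a => lt_trans a.2 hxy) hxy
  exact @PrincipalSeg.ordinal_type_lt _ _ _ _ (hT.predWellOrder x) (hT.predWellOrder y) seg

theorem countable_Iio_of_lt_omega_one {o : Ordinal} (ho : o < ω₁) : (Iio o).Countable := by
  rw [← Cardinal.le_aleph0_iff_set_countable, Cardinal.mk_Iio_ordinal,
    Cardinal.lift_le_aleph0, ← Cardinal.lt_aleph_one_iff, ← Cardinal.lt_ord, Cardinal.ord_aleph]
  exact ho

/-- A family of countable ordinals indexed by a countable set is bounded below `ω₁`. -/
theorem Set.Countable.exists_lt_omega_one {ι : Type*} {s : Set ι} (hs : s.Countable)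
    {f : ι → Ordinal} (hf : ∀ i ∈ s, f i < ω₁) : ∃ β < ω₁, ∀ i ∈ s, f i ≤ β := by
  rcases s.eq_empty_or_nonempty with rfl | hne
  · exact ⟨0, omega_pos 1, by simp⟩
  obtain ⟨e, rfl⟩ := hs.exists_eq_range hne
  exact ⟨⨆ n, f (e n), iSup_lt_omega_one fun n => hf _ ⟨n, rfl⟩, by
    rintro _ ⟨n, rfl⟩
    exact Ordinal.le_iSup (fun n => f (e n)) n⟩

/-- If for each `γ < ω₁` the ordinals `b i` with `a i < γ` are bounded below `ω₁`, then the
points `δ` of a club such that `a i < δ` implies `b i < δ` form a club. -/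
theorem IsClubBelowOmega1.closurePoints {C : Set Ordinal} (hC : IsClubBelowOmega1 C)
    {ι : Type*} (a b : ι → Ordinal)
    (h : ∀ γ < ω₁, ∃ β < ω₁, ∀ i, a i < γ → b i ≤ β) :
    IsClubBelowOmega1 {δ ∈ C | ∀ i, a i < δ → b i < δ} := by
  refine ⟨fun c hc => hC.1 c hc.1, fun o ho => ?_, fun S hS hne hb => ?_⟩
  · have step : ∀ γ : Ordinal, ∃ c ∈ C, γ < ω₁ → γ < c ∧ ∀ i, a i < γ → b i < c := by
      intro γ
      by_cases hγ : γ < ω₁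
      · obtain ⟨β, hβ, hab⟩ := h γ hγ
        obtain ⟨c, hc, hlt⟩ := hC.2.1 (max γ β) (max_lt hγ hβ)
        rw [max_lt_iff] at hlt
        exact ⟨c, hc, fun _ => ⟨hlt.1, fun i hi => (hab i hi).trans_lt hlt.2⟩⟩
      · obtain ⟨c, hc, -⟩ := hC.2.1 o ho
        exact ⟨c, hc, fun h => absurd h hγ⟩
    choose next hmem hnext using step
    let c : ℕ → Ordinal := fun n => next^[n + 1] o
    have hsucc : ∀ n, c (n + 1) = next (c n) := fun n => Function.iterate_succ_apply' next _ _
    have hcC : ∀ n, c n ∈ C := fun n => by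
      simp only [c, Function.iterate_succ_apply', hmem]
    have hc₁ : ∀ n, c n < ω₁ := fun n => hC.1 _ (hcC n)
    have hle : ∀ n, c n ≤ ⨆ n, c n := Ordinal.le_iSup c
    refine ⟨⨆ n, c n, ⟨?_, fun i hi => ?_⟩, (hnext o ho).1.trans_le (hle 0)⟩
    · exact hC.2.2 (range c) (range_subset_iff.2 hcC) (range_nonempty c)
        ⟨⨆ n, c n, iSup_lt_omega_one hc₁, forall_mem_range.2 hle⟩
    · obtain ⟨n, hn⟩ := Ordinal.lt_iSup_iff.1 hi
      refine lt_of_lt_of_le ?_ (hle (n + 1))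
      rw [hsucc]
      exact (hnext _ (hc₁ n)).2 i hn
  · refine ⟨hC.2.2 S (fun s hs => (hS hs).1) hne hb, fun i hi => ?_⟩
    obtain ⟨β, -, hβ⟩ := hb
    obtain ⟨s, hs, his⟩ := exists_lt_of_lt_csSup hne hi
    exact ((hS hs).2 i his).trans_le (le_csSup ⟨β, hβ⟩ hs)

/-- A regressive-selector criterion for being almost Souslin: let `T` be an `ω₁`-tree with
all levels countable, `C ⊆ ω₁` a club, and for each `β ∈ C` a function `g β` on the level
`T_β` with `g β x <_T x`, such that whenever `g β x = g γ y` (for `β, γ ∈ C`, `x ∈ T_β`,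
`y ∈ T_γ`) the points `x` and `y` are comparable. Then for every antichain `X ⊆ T` the set
of heights of elements of `X` is non-stationary in `ω₁`. -/
theorem regressive_selector_almost_souslin {α : Type*} [PartialOrder α] (ht : α → Ordinal)
    (hT : IsOmega1Tree ht)
    (hlevels : ∀ o < ω₁, {x : α | ht x = o}.Countable)
    (C : Set Ordinal) (hC : IsClubBelowOmega1 C)
    (g : Ordinal → α → α)
    (hreg : ∀ β ∈ C, ∀ x : α, ht x = β → g β x < x)
    (hcoh : ∀ β ∈ C, ∀ γ ∈ C, ∀ x y : α, ht x = β → ht y = γ →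
      g β x = g γ y → x ≤ y ∨ y ≤ x)
    (X : Set α) (hX : IsAntichain (· ≤ ·) X) :
    ∃ D : Set Ordinal, IsClubBelowOmega1 D ∧ D ∩ (ht '' X) = ∅ := by
  let Y : Set α := {x ∈ X | ht x ∈ C}
  have hinj : InjOn (fun x => g (ht x) x) Y := fun x hx y hy hxy => by
    rcases hcoh _ hx.2 _ hy.2 x y rfl rfl hxy with h | h
    · exact hX.eq hx.1 hy.1 h
    · exact (hX.eq hy.1 hx.1 h).symm
  refine ⟨_, hC.closurePoints (fun x : Y => ht (g (ht x) x)) (fun x : Y => ht x) ?_, ?_⟩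
  · intro γ hγ
    have hlow : {x | ht x < γ}.Countable :=
      ((countable_Iio_of_lt_omega_one hγ).biUnion fun o ho => hlevels o (ho.trans hγ)).mono
        fun x hx => mem_iUnion₂.2 ⟨ht x, hx, rfl⟩
    have hcount : {x : Y | ht (g (ht x) x) < γ}.Countable :=
      hlow.preimage_of_injOn (f := fun x : Y => g (ht x) x) hinj.injective.injOn
    exact hcount.exists_lt_omega_one fun x _ => hT.ht_lt x
  · rw [← disjoint_iff_inter_eq_empty, Set.disjoint_left]
    rintro _ ⟨hδ, hcl⟩ ⟨x, hx, rfl⟩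
    exact (hcl ⟨x, hx, hδ⟩ (hT.strictMono (hreg _ hδ x rfl))).false
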